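/- arXiv:0911.4165 — 4 statements merged into one kernel-verified Lean document; each statement's English description precedes it below -/
import Mathlib

section
/- Let f be a probability density on (0,∞) and let g : [0,∞) → ℝ be measurable and either Lebesgue integrable on [0,∞) or bounded. If ∫₀^∞ K(t,x)·g(x) dx = f(t) for almost every t > 0, then for every α > 0 all integrals below converge absolutely and ∫₀^∞ e^{−αx}·g(x) dx = ∫₀^∞ exp(−α·b(t) − t·α²/2)·f(t) dt. -/
open MeasureTheory Real Set

/-- The weight `exp (-α x)` makes every integrable or bounded measurable function integrable
on the half-line. -/
lemma integrableOn_exp_neg_mul {g : ℝ → ℝ} (hgmeas : Measurable g)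
    (hg : IntegrableOn g (Ici 0) ∨ ∃ M : ℝ, ∀ x ∈ Ici (0 : ℝ), |g x| ≤ M) {α : ℝ} (hα : 0 < α) :
    IntegrableOn (fun x => Real.exp (-α * x) * g x) (Ici 0) := by
  have hexp : Measurable fun x : ℝ => Real.exp (-α * x) := by fun_prop
  rcases hg with hg | ⟨M, hM⟩
  · refine Integrable.mono hg (hexp.mul hgmeas).aestronglyMeasurable ?_
    filter_upwards [ae_restrict_mem measurableSet_Ici] with x hx
    rw [norm_mul, Real.norm_of_nonneg (Real.exp_nonneg _)]
    refine mul_le_of_le_one_left (norm_nonneg _) (Real.exp_le_one_iff.2 ?_)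
    nlinarith [mem_Ici.1 hx]
  · have hint : IntegrableOn (fun x : ℝ => Real.exp (-α * x) * M) (Ici 0) :=
      ((integrableOn_Ici_iff_integrableOn_Ioi).2 (exp_neg_integrableOn_Ioi 0 hα)).mul_const M
    refine Integrable.mono' hint (hexp.mul hgmeas).aestronglyMeasurable ?_
    filter_upwards [ae_restrict_mem measurableSet_Ici] with x hx
    rw [norm_mul, Real.norm_of_nonneg (Real.exp_nonneg _)]
    exact mul_le_mul_of_nonneg_left (hM x hx) (Real.exp_nonneg _)

/-- **Randomized first passage time: Laplace transform identity.**
If `g` solves the Fredholm equation `∫ K(t,x) g(x) dx = f(t)` for the target density `f`,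
then the Laplace transform of `g` equals the boundary-specific transform of `f`. -/
theorem rfpt_laplace_transform
    (b : ℝ → ℝ) (hb : ContinuousOn b (Ici 0))
    (hbdd : ∀ α > (0 : ℝ), ∃ m : ℝ, ∀ t ∈ Ici (0 : ℝ), m ≤ b t + α * t)
    (K : ℝ → ℝ → ℝ) (hKmeas : Measurable (Function.uncurry K))
    (hKnonneg : ∀ t ∈ Ioi (0 : ℝ), ∀ x ∈ Ici (0 : ℝ), 0 ≤ K t x)
    (hK : ∀ x ∈ Ici (0 : ℝ), ∀ α > (0 : ℝ),
      ∫ t in Ioi (0 : ℝ), Real.exp (-α * b t - t * α ^ 2 / 2) * K t x = Real.exp (-α * x))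
    (f : ℝ → ℝ) (hfmeas : Measurable f) (hfnonneg : ∀ t ∈ Ioi (0 : ℝ), 0 ≤ f t)
    (hfint : ∫ t in Ioi (0 : ℝ), f t = 1)
    (g : ℝ → ℝ) (hgmeas : Measurable g)
    (hg : IntegrableOn g (Ici 0) ∨ ∃ M : ℝ, ∀ x ∈ Ici (0 : ℝ), |g x| ≤ M)
    (hsol : ∀ᵐ t ∂(volume.restrict (Ioi (0 : ℝ))), ∫ x in Ici (0 : ℝ), K t x * g x = f t) :
    ∀ α > (0 : ℝ),
      IntegrableOn (fun x => Real.exp (-α * x) * g x) (Ici 0) ∧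
      IntegrableOn (fun t => Real.exp (-α * b t - t * α ^ 2 / 2) * f t) (Ioi 0) ∧
      ∫ x in Ici (0 : ℝ), Real.exp (-α * x) * g x
        = ∫ t in Ioi (0 : ℝ), Real.exp (-α * b t - t * α ^ 2 / 2) * f t := by
  intro α hα
  have hLg := integrableOn_exp_neg_mul hgmeas hg hα
  set E : ℝ → ℝ := fun t => Real.exp (-α * b t - t * α ^ 2 / 2) with hE
  have hEmeas : AEStronglyMeasurable E (volume.restrict (Ioi 0)) := by
    refine ContinuousOn.aestronglyMeasurable ?_ measurableSet_Ioi
    have := hb.mono Ioi_subset_Ici_self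
    fun_prop
  have hKE : ∀ x ∈ Ici (0 : ℝ), ∫ t in Ioi (0 : ℝ), E t * K t x = Real.exp (-α * x) :=
    fun x hx => hK x hx α hα
  have hKEint : ∀ x ∈ Ici (0 : ℝ), IntegrableOn (fun t => E t * K t x) (Ioi 0) := fun x hx =>
    not_imp_comm.1 integral_undef (by rw [hKE x hx]; exact (Real.exp_pos _).ne')
  have hnorm : ∀ x ∈ Ici (0 : ℝ),
      ∫ t in Ioi (0 : ℝ), ‖E t * K t x * g x‖ = ‖Real.exp (-α * x) * g x‖ := by
    intro x hx
    rw [norm_mul, Real.norm_of_nonneg (Real.exp_nonneg _), ← hKE x hx, ← integral_mul_const]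
    refine setIntegral_congr_fun measurableSet_Ioi fun t ht => ?_
    simp only [norm_mul _ (g x)]
    rw [Real.norm_of_nonneg (mul_nonneg (Real.exp_nonneg _) (hKnonneg t ht x hx))]
  have hF : Integrable (Function.uncurry fun x t => E t * K t x * g x)
      ((volume.restrict (Ici (0 : ℝ))).prod (volume.restrict (Ioi (0 : ℝ)))) := by
    have hFmeas : AEStronglyMeasurable (Function.uncurry fun x t => E t * K t x * g x)
        ((volume.restrict (Ici (0 : ℝ))).prod (volume.restrict (Ioi (0 : ℝ)))) :=
      (hEmeas.comp_snd.mul (hKmeas.comp measurable_swap).aestronglyMeasurable).mul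
        (hgmeas.comp measurable_fst).aestronglyMeasurable
    refine (integrable_prod_iff hFmeas).2 ⟨?_, hLg.norm.congr ?_⟩
    · filter_upwards [ae_restrict_mem measurableSet_Ici] with x hx
      exact (hKEint x hx).mul_const (g x)
    · filter_upwards [ae_restrict_mem measurableSet_Ici] with x hx
      exact (hnorm x hx).symm
  have hinner : (fun t => ∫ x in Ici (0 : ℝ), E t * K t x * g x)
      =ᵐ[volume.restrict (Ioi (0 : ℝ))] fun t => E t * f t := by
    filter_upwards [hsol] with t ht
    simp_rw [mul_assoc]
    rw [integral_const_mul, ht]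
  refine ⟨hLg, hF.integral_prod_right.congr hinner, ?_⟩
  rw [← integral_congr_ae hinner, ← integral_integral_swap hF]
  refine setIntegral_congr_fun measurableSet_Ici fun x hx => ?_
  simp only [integral_mul_const, hKE x hx]
end

section
/- Let f be a probability density on (0,∞). If g₁, g₂ : [0,∞) → ℝ are measurable, each either Lebesgue integrable on [0,∞) or bounded, and ∫₀^∞ K(t,x)·g₁(x) dx = f(t) = ∫₀^∞ K(t,x)·g₂(x) dx for almost every t > 0, then g₁ = g₂ almost everywhere on [0,∞). -/
open MeasureTheory Real Set

/-- If all moments `∫ Y ^ n * u` vanish for a `[0,1]`-valued `Y`, then so do all integrals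
`∫ F (Y x) * u x` with `F` continuous. -/
lemma integral_comp_mul_eq_zero_of_moments {α : Type*} [MeasurableSpace α] {μ : Measure α}
    {Y u : α → ℝ} (hY : Measurable Y) (hY01 : ∀ᵐ x ∂μ, Y x ∈ Icc (0 : ℝ) 1)
    (hu : Integrable u μ) (hmom : ∀ n : ℕ, ∫ x, Y x ^ n * u x ∂μ = 0)
    {F : ℝ → ℝ} (hF : Continuous F) : ∫ x, F (Y x) * u x ∂μ = 0 := by
  have hint {G : ℝ → ℝ} (hG : Continuous G) : Integrable (fun x ↦ G (Y x) * u x) μ := by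
    obtain ⟨C, hC⟩ := isCompact_Icc.exists_bound_of_continuousOn (hG.continuousOn (s := Icc 0 1))
    refine hu.bdd_mul (c := C) (hG.measurable.comp hY).aestronglyMeasurable ?_
    filter_upwards [hY01] with x hx using hC _ hx
  have hpoly (P : Polynomial ℝ) : ∫ x, P.eval (Y x) * u x ∂μ = 0 := by
    simp_rw [Polynomial.eval_eq_sum_range, Finset.sum_mul, mul_assoc]
    rw [integral_finsetSum]
    · simp [integral_const_mul, hmom]
    · intro i _
      exact (hint (continuous_pow i)).const_mul _
  by_contra hne
  set I := ∫ x, F (Y x) * u x ∂μ with hI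
  set N := ∫ x, ‖u x‖ ∂μ
  have hN : 0 ≤ N := integral_nonneg fun _ ↦ norm_nonneg _
  obtain ⟨P, hP⟩ := exists_polynomial_near_of_continuousOn 0 1 F hF.continuousOn
    (|I| / (N + 1)) (by positivity)
  have hdiff : I = ∫ x, (F (Y x) - P.eval (Y x)) * u x ∂μ := by
    simp_rw [sub_mul]
    rw [integral_sub (hint hF) (hint P.continuous), hpoly, sub_zero]
  have hle : ‖I‖ ≤ ∫ x, |I| / (N + 1) * ‖u x‖ ∂μ := by
    conv_lhs => rw [hdiff]
    refine norm_integral_le_of_norm_le (hu.norm.const_mul _) ?_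
    filter_upwards [hY01] with x hx
    rw [norm_mul]
    gcongr
    rw [norm_eq_abs, abs_sub_comm]
    exact (hP _ hx).le
  rw [integral_const_mul, norm_eq_abs] at hle
  have hpos : 0 < |I| := abs_pos.mpr hne
  have : |I| / (N + 1) * N < |I| := by
    rw [div_mul_eq_mul_div, div_lt_iff₀ (by positivity)]
    nlinarith
  linarith

/-- An integrable function all of whose moments against an injective `[0,1]`-valued function
(with measurable left inverse) vanish is almost everywhere zero. -/
lemma ae_eq_zero_of_moments {α : Type*} [MeasurableSpace α] {μ : Measure α}
    {Y u : α → ℝ} {Z : ℝ → α} (hY : Measurable Y) (hZ : Measurable Z)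
    (hZY : Function.LeftInverse Z Y) (hY01 : ∀ᵐ x ∂μ, Y x ∈ Icc (0 : ℝ) 1)
    (hum : Measurable u) (hu : Integrable u μ) (hmom : ∀ n : ℕ, ∫ x, Y x ^ n * u x ∂μ = 0) :
    u =ᵐ[μ] 0 := by
  set p : α → ENNReal := fun x ↦ ENNReal.ofReal (u x)
  set q : α → ENNReal := fun x ↦ ENNReal.ofReal (-u x)
  have hp : Measurable p := hum.ennreal_ofReal
  have hq : Measurable q := hum.neg.ennreal_ofReal
  have hpfin : ∫⁻ x, p x ∂μ ≠ ⊤ := hu.lintegral_lt_top.ne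
  have hqfin : ∫⁻ x, q x ∂μ ≠ ⊤ := hu.neg.lintegral_lt_top.ne
  have : IsFiniteMeasure (μ.withDensity p) := isFiniteMeasure_withDensity hpfin
  have : IsFiniteMeasure (μ.withDensity q) := isFiniteMeasure_withDensity hqfin
  have hmap : (μ.withDensity p).map Y = (μ.withDensity q).map Y := by
    refine ext_of_forall_integral_eq_of_IsFiniteMeasure fun F ↦ ?_
    have hFY : Measurable fun x ↦ F (Y x) := F.continuous.measurable.comp hY
    have hint {v : α → ℝ} (hv : Integrable v μ) : Integrable (fun x ↦ v x * F (Y x)) μ :=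
      hv.mul_bdd (c := ‖F‖) hFY.aestronglyMeasurable (.of_forall fun x ↦ F.norm_coe_le_norm _)
    rw [integral_map hY.aemeasurable F.continuous.aestronglyMeasurable,
      integral_map hY.aemeasurable F.continuous.aestronglyMeasurable,
      integral_withDensity_eq_integral_toReal_smul hp (.of_forall fun _ ↦ ENNReal.ofReal_lt_top),
      integral_withDensity_eq_integral_toReal_smul hq (.of_forall fun _ ↦ ENNReal.ofReal_lt_top),
      ← sub_eq_zero]
    simp only [p, q, smul_eq_mul, ENNReal.toReal_ofReal']
    rw [← integral_sub (hint hu.pos_part) (hint hu.neg_part)]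
    refine Eq.trans ?_ (integral_comp_mul_eq_zero_of_moments hY hY01 hu hmom F.continuous)
    congr with x
    rw [← sub_mul, max_zero_sub_eq_self, mul_comm]
  have heq : μ.withDensity p = μ.withDensity q := by
    have := congrArg (Measure.map Z) hmap
    rwa [Measure.map_map hZ hY, Measure.map_map hZ hY, hZY.comp_eq_id, Measure.map_id,
      Measure.map_id] at this
  filter_upwards [(withDensity_eq_iff hp.aemeasurable hq.aemeasurable hpfin).mp heq] with x hx
  have := congrArg ENNReal.toReal hx
  simp only [p, q, ENNReal.toReal_ofReal'] at this
  have h := max_zero_sub_eq_self (u x)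
  rw [this, sub_self] at h
  exact h.symm

/-- Injectivity of the Laplace transform on `[0,∞)`. -/
lemma ae_eq_zero_of_laplace_eq_zero {h : ℝ → ℝ} (hm : Measurable h)
    (hi : IntegrableOn (fun x ↦ exp (-x) * h x) (Ici 0))
    (hz : ∀ α > (0 : ℝ), ∫ x in Ici (0 : ℝ), exp (-α * x) * h x = 0) :
    ∀ᵐ x ∂volume.restrict (Ici (0 : ℝ)), h x = 0 := by
  have key := ae_eq_zero_of_moments (μ := volume.restrict (Ici (0 : ℝ)))
    (Y := fun x ↦ exp (-x)) (Z := fun y ↦ -log y) (u := fun x ↦ exp (-x) * h x)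
    (by fun_prop) (by fun_prop) (fun x ↦ by simp) ?_ (by fun_prop) hi ?_
  · filter_upwards [key] with x hx
    simpa using hx
  · filter_upwards [ae_restrict_mem measurableSet_Ici] with x hx
    exact ⟨(exp_pos _).le, exp_le_one_iff.mpr (neg_nonpos.mpr hx)⟩
  · intro n
    refine Eq.trans ?_ (hz (n + 1) (by positivity))
    congr with x
    rw [← mul_assoc, ← exp_nat_mul, ← exp_add]
    ring_nf

lemma integrableOn_exp_neg_mul_mul {g : ℝ → ℝ} (hm : Measurable g)
    (hg : IntegrableOn g (Ici 0) ∨ ∃ M : ℝ, ∀ x ∈ Ici (0 : ℝ), |g x| ≤ M)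
    {α : ℝ} (hα : 0 < α) : IntegrableOn (fun x ↦ exp (-α * x) * g x) (Ici 0) := by
  rcases hg with hg | ⟨M, hM⟩
  · refine Integrable.bdd_mul (c := 1) hg (by fun_prop) ?_
    filter_upwards [ae_restrict_mem measurableSet_Ici] with x hx
    rw [norm_eq_abs, abs_exp, exp_le_one_iff]
    exact mul_nonpos_of_nonpos_of_nonneg (by linarith) hx
  · refine Integrable.mul_bdd (c := M) ?_ hm.aestronglyMeasurable ?_
    · exact (integrableOn_Ici_iff_integrableOn_Ioi).mpr (integrableOn_exp_mul_Ioi (by linarith) 0)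
    · filter_upwards [ae_restrict_mem measurableSet_Ici] with x hx using hM x hx

/-- A solution of the Fredholm equation `∫ K(t,x) g(x) dx = f(t)` has its Laplace transform
determined by `f`. -/
lemma integral_exp_mul_eq_of_solution {b : ℝ → ℝ} (hb : ContinuousOn b (Ici 0))
    {K : ℝ → ℝ → ℝ} (hKmeas : Measurable (Function.uncurry K))
    (hKnonneg : ∀ t ∈ Ioi (0 : ℝ), ∀ x ∈ Ici (0 : ℝ), 0 ≤ K t x)
    {α : ℝ} (hK : ∀ x ∈ Ici (0 : ℝ),
      ∫ t in Ioi (0 : ℝ), exp (-α * b t - t * α ^ 2 / 2) * K t x = exp (-α * x))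
    {f g : ℝ → ℝ} (hgmeas : Measurable g)
    (hg : IntegrableOn (fun x ↦ exp (-α * x) * g x) (Ici 0))
    (hsol : ∀ᵐ t ∂(volume.restrict (Ioi (0 : ℝ))), ∫ x in Ici (0 : ℝ), K t x * g x = f t) :
    ∫ x in Ici (0 : ℝ), exp (-α * x) * g x
      = ∫ t in Ioi (0 : ℝ), exp (-α * b t - t * α ^ 2 / 2) * f t := by
  set w : ℝ → ℝ := fun t ↦ exp (-α * b t - t * α ^ 2 / 2)
  have hw : AEStronglyMeasurable w (volume.restrict (Ioi 0)) := by
    refine ContinuousOn.aestronglyMeasurable ?_ measurableSet_Ioi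
    have := hb.mono Ioi_subset_Ici_self
    fun_prop
  have hKi (x : ℝ) (hx : x ∈ Ici (0 : ℝ)) : IntegrableOn (fun t ↦ w t * K t x) (Ioi 0) := by
    refine Integrable.of_integral_ne_zero ?_
    rw [hK x hx]
    exact (exp_pos _).ne'
  have hint : Integrable (Function.uncurry fun t x ↦ w t * K t x * g x)
      ((volume.restrict (Ioi (0 : ℝ))).prod (volume.restrict (Ici (0 : ℝ)))) := by
    refine (integrable_prod_iff' ?_).mpr ⟨?_, ?_⟩
    · exact (hw.comp_fst.mul hKmeas.aestronglyMeasurable).mul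
        (hgmeas.comp measurable_snd).aestronglyMeasurable
    · filter_upwards [ae_restrict_mem measurableSet_Ici] with x hx
      exact (hKi x hx).mul_const (g x)
    · refine hg.norm.congr ?_
      filter_upwards [ae_restrict_mem measurableSet_Ici] with x hx
      rw [norm_mul, norm_eq_abs, abs_exp, ← hK x hx, ← integral_mul_const]
      refine setIntegral_congr_fun measurableSet_Ioi fun t ht ↦ ?_
      simp only [Function.uncurry, norm_mul, w, norm_eq_abs, abs_exp,
        abs_of_nonneg (hKnonneg t ht x hx)]
  calc ∫ x in Ici (0 : ℝ), exp (-α * x) * g x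
      = ∫ x in Ici (0 : ℝ), ∫ t in Ioi (0 : ℝ), w t * K t x * g x := by
        refine setIntegral_congr_fun measurableSet_Ici fun x hx ↦ ?_
        simp only [integral_mul_const, w, hK x hx]
    _ = ∫ t in Ioi (0 : ℝ), ∫ x in Ici (0 : ℝ), w t * K t x * g x :=
        (integral_integral_swap hint).symm
    _ = ∫ t in Ioi (0 : ℝ), w t * f t := by
        refine integral_congr_ae ?_
        filter_upwards [hsol] with t ht
        simp_rw [mul_assoc, integral_const_mul, ht]

/-- **Uniqueness for the randomized first passage time problem.**
Two solutions (in the class of integrable-or-bounded measurable functions) of the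
Fredholm equation `∫ K(t,x) g(x) dx = f(t)` agree almost everywhere on `[0,∞)`. -/
theorem rfpt_uniqueness
    (b : ℝ → ℝ) (hb : ContinuousOn b (Ici 0))
    (hbdd : ∀ α > (0 : ℝ), ∃ m : ℝ, ∀ t ∈ Ici (0 : ℝ), m ≤ b t + α * t)
    (K : ℝ → ℝ → ℝ) (hKmeas : Measurable (Function.uncurry K))
    (hKnonneg : ∀ t ∈ Ioi (0 : ℝ), ∀ x ∈ Ici (0 : ℝ), 0 ≤ K t x)
    (hK : ∀ x ∈ Ici (0 : ℝ), ∀ α > (0 : ℝ),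
      ∫ t in Ioi (0 : ℝ), Real.exp (-α * b t - t * α ^ 2 / 2) * K t x = Real.exp (-α * x))
    (f : ℝ → ℝ) (hfmeas : Measurable f) (hfnonneg : ∀ t ∈ Ioi (0 : ℝ), 0 ≤ f t)
    (hfint : ∫ t in Ioi (0 : ℝ), f t = 1)
    (g₁ g₂ : ℝ → ℝ) (hg₁meas : Measurable g₁) (hg₂meas : Measurable g₂)
    (hg₁ : IntegrableOn g₁ (Ici 0) ∨ ∃ M : ℝ, ∀ x ∈ Ici (0 : ℝ), |g₁ x| ≤ M)
    (hg₂ : IntegrableOn g₂ (Ici 0) ∨ ∃ M : ℝ, ∀ x ∈ Ici (0 : ℝ), |g₂ x| ≤ M)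
    (hsol₁ : ∀ᵐ t ∂(volume.restrict (Ioi (0 : ℝ))), ∫ x in Ici (0 : ℝ), K t x * g₁ x = f t)
    (hsol₂ : ∀ᵐ t ∂(volume.restrict (Ioi (0 : ℝ))), ∫ x in Ici (0 : ℝ), K t x * g₂ x = f t) :
    ∀ᵐ x ∂(volume.restrict (Ici (0 : ℝ))), g₁ x = g₂ x := by
  have hi₁ {α : ℝ} (hα : 0 < α) := integrableOn_exp_neg_mul_mul hg₁meas hg₁ hα
  have hi₂ {α : ℝ} (hα : 0 < α) := integrableOn_exp_neg_mul_mul hg₂meas hg₂ hα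
  have key : ∀ᵐ x ∂(volume.restrict (Ici (0 : ℝ))), g₁ x - g₂ x = 0 := by
    refine ae_eq_zero_of_laplace_eq_zero (hg₁meas.sub hg₂meas) ?_ fun α hα ↦ ?_
    · simpa [mul_sub, Pi.sub_def] using (hi₁ one_pos).sub (hi₂ one_pos)
    · simp_rw [mul_sub]
      rw [integral_sub (hi₁ hα) (hi₂ hα),
        integral_exp_mul_eq_of_solution hb hKmeas hKnonneg (fun x hx ↦ hK x hx α hα) hg₁meas
          (hi₁ hα) hsol₁,
        integral_exp_mul_eq_of_solution hb hKmeas hKnonneg (fun x hx ↦ hK x hx α hα) hg₂meas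
          (hi₂ hα) hsol₂, sub_self]
  filter_upwards [key] with x hx using sub_eq_zero.mp hx
end

section
/- Assume there exists t > 0 with b(t) > 0. Let f be a probability density on (0,∞) and let g : (0,∞) → ℝ be measurable, either Lebesgue integrable on (0,∞) or bounded, with ∫₀^∞ g(x)²·e^{−x²} dx < ∞, and suppose ∫₀^∞ K(t,x)·g(x) dx = f(t) for almost every t > 0. Then: (i) for every t > 0 with b(t) > 0 and every integer n ≥ 0, ∫₀^∞ e^{−x²/(2t)}·H_n(x/√(2t))·g(x) dx = t^{(n+1)/2}·a_n(t), where a_n(t) := ∫₀^t (t−s)^{−(n+1)/2}·e^{−b(s)²/(2(t−s))}·H_n(b(s)/√(2(t−s)))·f(s) ds; (ii) consequently any two such solutions g agree almost everywhere on (0,∞). -/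
open MeasureTheory Real Set

/-- The physicists' Hermite polynomial of degree `n`,
`H_n(x) = (−1)^n e^{x²} (d/dx)^n e^{−x²}`. -/
noncomputable def physHermite (n : ℕ) (x : ℝ) : ℝ :=
  (-1) ^ n * Real.exp (x ^ 2) * iteratedDeriv n (fun y => Real.exp (-y ^ 2)) x

open ProbabilityTheory Filter Topology in
/-- Two measures on `ℝ` with finite exponential moments and equal moments coincide. -/
theorem measure_eq_of_moments_eq {μ ν : Measure ℝ}
    (hμ : ∀ c : ℝ, Integrable (fun x => exp (c * x)) μ)
    (hν : ∀ c : ℝ, Integrable (fun x => exp (c * x)) ν)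
    (h : ∀ n : ℕ, ∫ x, x ^ n ∂μ = ∫ x, x ^ n ∂ν) : μ = ν := by
  have : IsFiniteMeasure μ := by
    have := hμ 0
    simpa [integrable_const_iff, isFiniteMeasure_iff] using this
  have : IsFiniteMeasure ν := by
    have := hν 0
    simpa [integrable_const_iff, isFiniteMeasure_iff] using this
  have hsetμ : integrableExpSet id μ = univ := eq_univ_of_forall fun c => hμ c
  have hsetν : integrableExpSet id ν = univ := eq_univ_of_forall fun c => hν c
  have hAμ : AnalyticOnNhd ℝ (mgf id μ) univ := by
    simpa [hsetμ] using analyticOnNhd_mgf (X := id) (μ := μ)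
  have hAν : AnalyticOnNhd ℝ (mgf id ν) univ := by
    simpa [hsetν] using analyticOnNhd_mgf (X := id) (μ := ν)
  have hmgf : mgf id μ = mgf id ν := by
    refine hAμ.eq_of_eventuallyEq hAν (z₀ := 0) ?_
    have e1 := hasFPowerSeriesAt_mgf (X := id) (μ := μ) (v := 0) (by simp [hsetμ])
    have e2 := hasFPowerSeriesAt_mgf (X := id) (μ := ν) (v := 0) (by simp [hsetν])
    simp only [id, zero_mul, exp_zero, mul_one, h] at e1 e2
    have e3 := e1.sub e2
    rw [sub_self] at e3
    filter_upwards [e3.eventually_eq_zero] with x hx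
    simpa [sub_eq_zero] using hx
  have hzero : μ = 0 ↔ ν = 0 := by
    have h0 := h 0
    simp only [pow_zero, integral_const, smul_eq_mul, mul_one] at h0
    rw [← Measure.measure_univ_eq_zero, ← Measure.measure_univ_eq_zero,
      ← measureReal_eq_zero_iff, ← measureReal_eq_zero_iff, h0]
  refine Measure.ext_of_complexMGF_id_eq (funext fun z => ?_)
  exact eqOn_complexMGF_of_mgf' hmgf hzero (by simp [hsetμ])

/-- A function all of whose moments vanish is zero, provided it decays fast enough. -/
theorem ae_eq_zero_of_moments_eq_zero {μ : Measure ℝ} [SigmaFinite μ] {w : ℝ → ℝ}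
    (hw : Measurable w) (hexp : ∀ c : ℝ, Integrable (fun x => exp (c * x) * w x) μ)
    (h : ∀ n : ℕ, ∫ x, x ^ n * w x ∂μ = 0) : w =ᵐ[μ] 0 := by
  have key : ∀ v : ℝ → ℝ, Measurable v → (∀ c : ℝ, Integrable (fun x => exp (c * x) * v x) μ) →
      ∀ c : ℝ, Integrable (fun x => exp (c * x)) (μ.withDensity fun x => ENNReal.ofReal (v x)) := by
    intro v hv hvi c
    rw [integrable_withDensity_iff_integrable_smul' hv.ennreal_ofReal (by simp)]
    refine (hvi c).mono (by fun_prop) (Filter.Eventually.of_forall fun x => ?_)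
    simp only [ENNReal.toReal_ofReal', smul_eq_mul, norm_mul, norm_eq_abs]
    rw [mul_comm]
    refine mul_le_mul_of_nonneg_left ?_ (abs_nonneg _)
    rw [abs_of_nonneg (le_max_right (v x) 0)]
    exact max_le (le_abs_self _) (abs_nonneg _)
  have hpos := key w hw hexp
  have hneg := key (fun x => -w x) hw.fun_neg (fun c => by simpa using (hexp c).neg)
  have hpow : ∀ v : ℝ → ℝ, Measurable v → (∀ c : ℝ, Integrable (fun x => exp (c * x))
      (μ.withDensity fun x => ENNReal.ofReal (v x))) → ∀ n : ℕ,
      Integrable (fun x => max (v x) 0 * x ^ n) μ := by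
    intro v hv hvi n
    have := ProbabilityTheory.integrable_pow_of_mem_interior_integrableExpSet (X := id)
      (μ := μ.withDensity fun x => ENNReal.ofReal (v x)) (by
        rw [eq_univ_of_forall (s := ProbabilityTheory.integrableExpSet id _) fun c => hvi c]
        simp) n
    rw [integrable_withDensity_iff_integrable_smul' hv.ennreal_ofReal (by simp)] at this
    simpa [ENNReal.toReal_ofReal'] using this
  have heq := measure_eq_of_moments_eq hpos hneg fun n => by
    rw [integral_withDensity_eq_integral_toReal_smul hw.ennreal_ofReal (by simp),
      integral_withDensity_eq_integral_toReal_smul hw.fun_neg.ennreal_ofReal (by simp),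
      ← sub_eq_zero]
    simp only [ENNReal.toReal_ofReal', smul_eq_mul]
    rw [← integral_sub (hpow w hw hpos n) (hpow _ hw.fun_neg hneg n)]
    refine Eq.trans (integral_congr_ae (Filter.Eventually.of_forall fun x => ?_)) (h n)
    simp only [← sub_mul]
    rw [max_zero_sub_max_neg_zero_eq_self, mul_comm]
  rw [withDensity_eq_iff_of_sigmaFinite hw.ennreal_ofReal.aemeasurable
    hw.fun_neg.ennreal_ofReal.aemeasurable] at heq
  filter_upwards [heq] with x hx
  rcases lt_trichotomy (w x) 0 with h0 | h0 | h0
  · rw [ENNReal.ofReal_of_nonpos h0.le, eq_comm, ENNReal.ofReal_eq_zero] at hx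
    linarith
  · exact h0
  · rw [ENNReal.ofReal_of_nonpos (by linarith : -w x ≤ 0), ENNReal.ofReal_eq_zero] at hx
    linarith

open Polynomial in
theorem physHermite_eq_hermite (n : ℕ) (x : ℝ) :
    physHermite n x = sqrt 2 ^ n * aeval (sqrt 2 * x) (hermite n) := by
  have h2 : sqrt 2 ^ 2 = 2 := sq_sqrt (by norm_num)
  have hfun : (fun y : ℝ => exp (-y ^ 2)) = fun y => exp (-((sqrt 2 * y) ^ 2 / 2)) := by
    funext y
    rw [mul_pow, h2]
    ring_nf
  have hc : ContDiff ℝ n (fun y : ℝ => exp (-(y ^ 2 / 2))) := by fun_prop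
  rw [physHermite, hfun, iteratedDeriv_comp_const_mul hc, iteratedDeriv_eq_iterate]
  simp only
  rw [hermite_eq_deriv_gaussian', mul_pow, h2]
  ring_nf

open Polynomial in
theorem physHermite_div_sqrt_two_mul (n : ℕ) (t y : ℝ) :
    physHermite n (y / sqrt (2 * t))
      = sqrt 2 ^ n * ((hermite n).map (Int.castRingHom ℝ)).eval (y / sqrt t) := by
  rw [physHermite_eq_hermite, sqrt_mul (by norm_num), aeval_def, eval₂_eq_eval_map]
  have : sqrt 2 ≠ 0 := by positivity
  congr 2
  field_simp

open Polynomial in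
theorem span_range_hermite_map :
    Submodule.span ℝ (Set.range fun n => (hermite n).map (Int.castRingHom ℝ)) = ⊤ := by
  let S : Polynomial.Sequence ℝ :=
    ⟨fun n => (hermite n).map (Int.castRingHom ℝ), fun n => by
      rw [(hermite_monic n).degree_map, degree_hermite]⟩
  exact S.span fun n => by
    have : (S n).leadingCoeff = 1 := (hermite_monic n).map _
    simp [this]

open Polynomial in
/-- A polynomial grows more slowly than any Gaussian. -/
theorem exists_abs_eval_mul_exp_le (p : ℝ[X]) {a : ℝ} (ha : 0 < a) :
    ∃ C, 0 ≤ C ∧ ∀ y : ℝ, |p.eval y| * exp (-(a * y ^ 2)) ≤ C := by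
  induction p using Polynomial.induction_on' with
  | add p q hp hq =>
    obtain ⟨C, hC0, hC⟩ := hp
    obtain ⟨D, hD0, hD⟩ := hq
    refine ⟨C + D, by positivity, fun y => ?_⟩
    rw [eval_add]
    calc _ ≤ (|p.eval y| + |q.eval y|) * exp (-(a * y ^ 2)) := by gcongr; exact abs_add_le _ _
      _ ≤ C + D := by rw [add_mul]; exact add_le_add (hC y) (hD y)
  | monomial n k =>
    refine ⟨|k| * (n.factorial * exp (1 / (4 * a))), by positivity, fun y => ?_⟩
    have h1 := pow_div_factorial_le_exp |y| (abs_nonneg y) n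
    rw [div_le_iff₀ (by positivity)] at h1
    have h2 : |y| ≤ 1 / (4 * a) + a * y ^ 2 := by
      rw [← sq_abs y]
      have : 0 ≤ a * (|y| - 1 / (2 * a)) ^ 2 := by positivity
      have e : a * (|y| - 1 / (2 * a)) ^ 2 = a * |y| ^ 2 - |y| + 1 / (4 * a) := by
        field_simp; ring
      linarith
    simp only [eval_monomial, abs_mul, abs_pow]
    rw [mul_assoc]
    refine mul_le_mul_of_nonneg_left ?_ (abs_nonneg k)
    calc |y| ^ n * exp (-(a * y ^ 2))
        ≤ exp (1 / (4 * a) + a * y ^ 2) * n.factorial * exp (-(a * y ^ 2)) := by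
          gcongr
          exact h1.trans (by gcongr)
      _ = n.factorial * exp (1 / (4 * a)) := by
          rw [exp_add, exp_neg]
          field_simp

theorem integrableOn_exp_neg_mul_sq_mul {g : ℝ → ℝ} (hg : Measurable g)
    (hclass : IntegrableOn g (Ioi 0) ∨ ∃ M : ℝ, ∀ x ∈ Ioi (0 : ℝ), |g x| ≤ M) {a : ℝ}
    (ha : 0 < a) : IntegrableOn (fun x => exp (-(a * x ^ 2)) * g x) (Ioi 0) := by
  rcases hclass with h | ⟨M, hM⟩
  · refine Integrable.bdd_mul (c := 1) h (by fun_prop) (Filter.Eventually.of_forall fun x => ?_)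
    rw [norm_eq_abs, abs_exp, exp_le_one_iff]
    have : 0 ≤ a * x ^ 2 := by positivity
    linarith
  · refine Integrable.mul_bdd (c := M) ?_ hg.aestronglyMeasurable
      ((ae_restrict_iff' measurableSet_Ioi).2 (Filter.Eventually.of_forall hM))
    simpa using! (integrable_exp_neg_mul_sq ha).integrableOn (s := Ioi 0)

/-- The kernel relating the Hermite functions to the first-passage density. -/
noncomputable def boundaryKernel (b : ℝ → ℝ) (n : ℕ) (t s : ℝ) : ℝ :=
  (t - s) ^ (-(((n : ℝ) + 1) / 2)) * exp (-(b s) ^ 2 / (2 * (t - s)))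
    * physHermite n (b s / sqrt (2 * (t - s)))

theorem rpow_neg_half_eq_inv_sqrt_pow (n : ℕ) {r : ℝ} (hr : 0 ≤ r) :
    r ^ (-(((n : ℝ) + 1) / 2)) = (1 / sqrt r) ^ (n + 1) := by
  rw [rpow_neg hr, sqrt_eq_rpow, one_div, inv_pow, ← rpow_natCast, ← rpow_mul hr]
  congr 2
  push_cast
  ring

open Polynomial in
theorem boundaryKernel_eq (b : ℝ → ℝ) (n : ℕ) {t s : ℝ} (hs : s < t) :
    boundaryKernel b n t s = sqrt 2 ^ n
      * (((hermite n).map (Int.castRingHom ℝ)).eval (b s / sqrt (t - s))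
        * exp (-(1 / 4 * (b s / sqrt (t - s)) ^ 2)))
      * ((1 / sqrt (t - s)) ^ (n + 1) * exp (-(1 / 4 * (b s / sqrt (t - s)) ^ 2))) := by
  have hr : 0 < t - s := by linarith
  rw [boundaryKernel, physHermite_div_sqrt_two_mul, rpow_neg_half_eq_inv_sqrt_pow n hr.le]
  have : exp (-(b s) ^ 2 / (2 * (t - s))) = exp (-(1 / 4 * (b s / sqrt (t - s)) ^ 2))
      * exp (-(1 / 4 * (b s / sqrt (t - s)) ^ 2)) := by
    rw [← exp_add, div_pow, sq_sqrt hr.le]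
    congr 1
    field_simp
    ring
  rw [this]
  ring

open Polynomial in
theorem continuousOn_boundaryKernel {b : ℝ → ℝ} (hb : ContinuousOn b (Ici 0)) (n : ℕ) (t : ℝ) :
    ContinuousOn (boundaryKernel b n t) (Ioo 0 t) := by
  have hb' : ContinuousOn b (Ioo 0 t) := hb.mono fun s hs => hs.1.le
  have hroot : ContinuousOn (fun s => sqrt (t - s)) (Ioo 0 t) := by fun_prop
  have hne : ∀ s ∈ Ioo 0 t, sqrt (t - s) ≠ 0 := fun s hs =>
    (sqrt_pos.2 (sub_pos.2 hs.2)).ne'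
  have hq : ContinuousOn (fun s => b s / sqrt (t - s)) (Ioo 0 t) := hb'.div hroot hne
  have hi : ContinuousOn (fun s => 1 / sqrt (t - s)) (Ioo 0 t) := continuousOn_const.div hroot hne
  have he : ContinuousOn (fun s => ((hermite n).map (Int.castRingHom ℝ)).eval (b s / sqrt (t - s)))
      (Ioo 0 t) := (Polynomial.continuous _).comp_continuousOn hq
  refine ContinuousOn.congr ?_ fun s hs => boundaryKernel_eq b n hs.2
  fun_prop

open Polynomial Filter Topology in
theorem exists_abs_boundaryKernel_le {b : ℝ → ℝ} (hb : ContinuousOn b (Ici 0)) (n : ℕ) {t : ℝ}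
    (ht : 0 < t) (hbt : 0 < b t) :
    ∃ C, ∀ s ∈ Ioo 0 t, |boundaryKernel b n t s| ≤ C := by
  obtain ⟨C₁, hC₁0, hC₁⟩ := exists_abs_eval_mul_exp_le
    ((hermite n).map (Int.castRingHom ℝ)) (a := 1 / 4) (by norm_num)
  obtain ⟨C₂, hC₂0, hC₂⟩ := exists_abs_eval_mul_exp_le
    (X ^ (n + 1)) (a := (b t / 2) ^ 2 / 4) (by positivity)
  have hbnhds : ∀ᶠ s in 𝓝 t, b t / 2 < b s :=
    (hb.continuousAt (Ici_mem_nhds ht)).eventually_const_lt (by linarith)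
  obtain ⟨δ, hδ, hball⟩ := Metric.eventually_nhds_iff.1 hbnhds
  refine ⟨sqrt 2 ^ n * C₁ * (C₂ + (1 / sqrt δ) ^ (n + 1)), fun s hs => ?_⟩
  have hr : 0 < t - s := by linarith [hs.2]
  rw [boundaryKernel_eq b n hs.2]
  simp only [abs_mul, abs_exp, abs_pow]
  rw [abs_of_nonneg (sqrt_nonneg 2), abs_of_nonneg (by positivity : 0 ≤ 1 / sqrt (t - s))]
  gcongr
  · exact hC₁ _
  · rcases lt_or_ge (t - s) δ with h | h
    · have hbs : b t / 2 < b s := hball (by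
        rw [dist_comm, Real.dist_eq, abs_of_pos hr]; exact h)
      refine le_add_of_le_of_nonneg ?_ (by positivity)
      refine le_trans ?_ (hC₂ (1 / sqrt (t - s)))
      rw [eval_pow, eval_X, abs_of_nonneg (by positivity : 0 ≤ (1 / sqrt (t - s)) ^ (n + 1))]
      have e : 1 / 4 * (b s / sqrt (t - s)) ^ 2 = b s ^ 2 / 4 * (1 / sqrt (t - s)) ^ 2 := by ring
      rw [e]
      gcongr
    · refine le_add_of_nonneg_of_le hC₂0 ?_
      refine (mul_le_of_le_one_right (by positivity) ?_).trans (by gcongr)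
      rw [exp_le_one_iff]
      have : 0 ≤ 1 / 4 * (b s / sqrt (t - s)) ^ 2 := by positivity
      linarith

theorem boundaryKernel_zero (b : ℝ → ℝ) (t s : ℝ) :
    boundaryKernel b 0 t s = (t - s) ^ (-(1 / 2 : ℝ)) * exp (-(b s) ^ 2 / (2 * (t - s))) := by
  simp [boundaryKernel, physHermite, ← exp_add]

open Filter Topology in
/-- The mass before time `t` of the first-passage density from `x` has a Gaussian tail in `x`. -/
theorem exists_integral_le_of_boundaryKernel
    {b : ℝ → ℝ} (hb : ContinuousOn b (Ici 0))
    {K : ℝ → ℝ → ℝ} (hKmeas : Measurable (Function.uncurry K))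
    (hKnonneg : ∀ t ∈ Ioi (0 : ℝ), ∀ x ∈ Ioi (0 : ℝ), 0 ≤ K t x)
    (hK : ∀ x ∈ Ioi (0 : ℝ), ∀ t ∈ Ioi (0 : ℝ), 0 < b t →
      t ^ (-(1 / 2) : ℝ) * exp (-x ^ 2 / (2 * t))
        = ∫ s in Ioo (0 : ℝ) t, boundaryKernel b 0 t s * K s x)
    {t : ℝ} (ht : 0 < t) (hbt : 0 < b t) :
    ∃ C a : ℝ, 0 < a ∧ ∀ x ∈ Ioi (0 : ℝ), IntegrableOn (fun s => K s x) (Ioo 0 t) ∧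
      ∫ s in Ioo 0 t, K s x ≤ C * exp (-(a * x ^ 2)) := by
  obtain ⟨t₁, hbt₁, htt₁⟩ : ∃ t₁, 0 < b t₁ ∧ t < t₁ := by
    have h1 : ∀ᶠ s in 𝓝 t, 0 < b s :=
      (hb.continuousAt (Ici_mem_nhds ht)).eventually_const_lt hbt
    exact ((h1.filter_mono nhdsWithin_le_nhds).and (self_mem_nhdsWithin (s := Ioi t))).exists
  have ht₁ : 0 < t₁ := ht.trans htt₁
  obtain ⟨B, hB⟩ := isCompact_Icc.exists_bound_of_continuousOn
    (hb.mono fun s (hs : s ∈ Icc 0 t) => hs.1)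
  set m := t₁ ^ (-(1 / 2) : ℝ) * exp (-B ^ 2 / (2 * (t₁ - t))) with hm
  have hm0 : 0 < m := by positivity
  have hlow : ∀ s ∈ Ioo 0 t, m ≤ boundaryKernel b 0 t₁ s := by
    intro s hs
    have h0 : 0 < t₁ - t := by linarith
    have h1 : t₁ - t ≤ t₁ - s := by linarith [hs.2]
    have h2 : b s ^ 2 ≤ B ^ 2 := sq_le_sq' (abs_le.1 (hB s ⟨hs.1.le, hs.2.le⟩)).1
      (abs_le.1 (hB s ⟨hs.1.le, hs.2.le⟩)).2
    rw [hm, boundaryKernel_zero, neg_div, neg_div]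
    refine mul_le_mul ?_ ?_ (exp_nonneg _) (rpow_nonneg (by linarith) _)
    · exact rpow_le_rpow_of_nonpos (by linarith) (by linarith [hs.1]) (by norm_num)
    · gcongr
  have hnonneg : ∀ s ∈ Ioo 0 t₁, ∀ x ∈ Ioi (0 : ℝ), 0 ≤ boundaryKernel b 0 t₁ s * K s x := by
    intro s hs x hx
    refine mul_nonneg ?_ (hKnonneg s hs.1 x hx)
    rw [boundaryKernel_zero]
    exact mul_nonneg (rpow_nonneg (by linarith [hs.2]) _) (exp_nonneg _)
  refine ⟨m⁻¹ * t₁ ^ (-(1 / 2) : ℝ), 1 / (2 * t₁), by positivity, fun x hx => ?_⟩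
  have hsub : Ioo 0 t ⊆ Ioo 0 t₁ := Ioo_subset_Ioo_right htt₁.le
  have hInt : IntegrableOn (fun s => boundaryKernel b 0 t₁ s * K s x) (Ioo 0 t₁) := by
    by_contra hni
    have := hK x hx t₁ ht₁ hbt₁
    rw [integral_undef hni] at this
    have hpos : 0 < t₁ ^ (-(1 / 2) : ℝ) * exp (-x ^ 2 / (2 * t₁)) := by positivity
    exact hpos.ne' this
  have hle : ∀ s ∈ Ioo 0 t, K s x ≤ m⁻¹ * (boundaryKernel b 0 t₁ s * K s x) := by
    intro s hs
    rw [← mul_assoc]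
    refine le_mul_of_one_le_left (hKnonneg s hs.1 x hx) ?_
    rw [inv_mul_eq_div, one_le_div hm0]
    exact hlow s hs
  have hKx : Measurable fun s => K s x := hKmeas.comp measurable_prodMk_right
  have hInt' : IntegrableOn (fun s => m⁻¹ * (boundaryKernel b 0 t₁ s * K s x)) (Ioo 0 t) :=
    (hInt.mono_set hsub).const_mul _
  have hKint : IntegrableOn (fun s => K s x) (Ioo 0 t) := by
    refine hInt'.mono' hKx.aestronglyMeasurable
      ((ae_restrict_iff' measurableSet_Ioo).2 (Eventually.of_forall fun s hs => ?_))
    rw [norm_eq_abs, abs_of_nonneg (hKnonneg s hs.1 x hx)]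
    exact hle s hs
  refine ⟨hKint, ?_⟩
  calc ∫ s in Ioo 0 t, K s x
      ≤ ∫ s in Ioo 0 t, m⁻¹ * (boundaryKernel b 0 t₁ s * K s x) :=
        setIntegral_mono_on hKint hInt' measurableSet_Ioo hle
    _ = m⁻¹ * ∫ s in Ioo 0 t, boundaryKernel b 0 t₁ s * K s x := integral_const_mul _ _
    _ ≤ m⁻¹ * ∫ s in Ioo 0 t₁, boundaryKernel b 0 t₁ s * K s x := by
        refine mul_le_mul_of_nonneg_left ?_ (by positivity)
        exact setIntegral_mono_set hInt ((ae_restrict_iff' measurableSet_Ioo).2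
          (Eventually.of_forall fun s hs => hnonneg s hs x hx)) hsub.eventuallyLE
    _ = _ := by
        rw [← hK x hx t₁ ht₁ hbt₁, mul_assoc]
        congr 3
        field_simp

/-- Against a function with Gaussian-integrable growth, a kernel whose partial masses have a
Gaussian tail is integrable on the product space. -/
theorem integrable_kernel_mul_prod
    {K : ℝ → ℝ → ℝ} (hKmeas : Measurable (Function.uncurry K))
    (hKnonneg : ∀ t ∈ Ioi (0 : ℝ), ∀ x ∈ Ioi (0 : ℝ), 0 ≤ K t x) {t C a : ℝ}
    (hK : ∀ x ∈ Ioi (0 : ℝ), IntegrableOn (fun s => K s x) (Ioo 0 t) ∧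
      ∫ s in Ioo 0 t, K s x ≤ C * exp (-(a * x ^ 2)))
    {g : ℝ → ℝ} (hg : Measurable g)
    (hgint : IntegrableOn (fun x => exp (-(a * x ^ 2)) * g x) (Ioi 0)) :
    Integrable (fun p : ℝ × ℝ => K p.1 p.2 * g p.2)
      ((volume.restrict (Ioo 0 t)).prod (volume.restrict (Ioi 0))) := by
  have hmeas : Measurable fun p : ℝ × ℝ => K p.1 p.2 * g p.2 :=
    Measurable.mul hKmeas (hg.comp measurable_snd)
  rw [integrable_prod_iff' hmeas.aestronglyMeasurable]
  refine ⟨(ae_restrict_iff' measurableSet_Ioi).2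
    (Filter.Eventually.of_forall fun x hx => (hK x hx).1.mul_const (g x)), ?_⟩
  refine (hgint.norm.const_mul C).mono'
    hmeas.stronglyMeasurable.norm.integral_prod_left'.aestronglyMeasurable
    ((ae_restrict_iff' measurableSet_Ioi).2 (Filter.Eventually.of_forall fun x hx => ?_))
  have : ∫ s in Ioo 0 t, ‖K s x * g x‖ = (∫ s in Ioo 0 t, K s x) * |g x| := by
    rw [← integral_mul_const]
    refine setIntegral_congr_fun measurableSet_Ioo fun s hs => ?_
    simp only [norm_mul, norm_eq_abs, abs_of_nonneg (hKnonneg s hs.1 x hx)]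
  simp only [this]
  simp only [norm_mul, norm_eq_abs, abs_exp, abs_abs]
  rw [abs_of_nonneg (setIntegral_nonneg measurableSet_Ioo fun s hs => hKnonneg s hs.1 x hx),
    ← mul_assoc]
  exact mul_le_mul_of_nonneg_right (hK x hx).2 (abs_nonneg _)

theorem exp_neg_sq_div_two_mul {t : ℝ} (x : ℝ) :
    exp (-x ^ 2 / (2 * t)) = exp (-(1 / (4 * t) * x ^ 2)) * exp (-(1 / (4 * t) * x ^ 2)) := by
  rw [← exp_add]
  congr 1
  ring

open Polynomial in
theorem integrableOn_eval_mul_exp_mul {h : ℝ → ℝ} {t : ℝ} (ht : 0 < t)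
    (hInt : IntegrableOn (fun x => exp (-(1 / (4 * t) * x ^ 2)) * h x) (Ioi 0)) (p : ℝ[X]) :
    IntegrableOn (fun x => p.eval (x / sqrt t) * (exp (-x ^ 2 / (2 * t)) * h x)) (Ioi 0) := by
  obtain ⟨C, -, hC⟩ := exists_abs_eval_mul_exp_le p (a := 1 / 4) (by norm_num)
  have hc : Continuous fun x => p.eval (x / sqrt t) * exp (-(1 / (4 * t) * x ^ 2)) := by
    have := p.continuous.comp (continuous_id.div_const (sqrt t))
    exact this.mul (by fun_prop)
  have := Integrable.bdd_mul (c := C) hInt hc.aestronglyMeasurable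
    (Filter.Eventually.of_forall fun x => by
      have e : 1 / (4 * t) * x ^ 2 = 1 / 4 * (x / sqrt t) ^ 2 := by
        rw [div_pow, sq_sqrt ht.le]
        field_simp
      rw [norm_mul, norm_eq_abs, norm_eq_abs, abs_exp, e]
      exact hC _)
  refine this.congr (Filter.Eventually.of_forall fun x => ?_)
  simp only [exp_neg_sq_div_two_mul x]
  ring

open Polynomial in
theorem integrableOn_exp_mul_physHermite_mul {g : ℝ → ℝ} (hg : Measurable g)
    (hclass : IntegrableOn g (Ioi 0) ∨ ∃ M : ℝ, ∀ x ∈ Ioi (0 : ℝ), |g x| ≤ M)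
    {t : ℝ} (ht : 0 < t) (n : ℕ) :
    IntegrableOn (fun x => exp (-x ^ 2 / (2 * t)) * physHermite n (x / sqrt (2 * t)) * g x)
      (Ioi 0) := by
  refine ((integrableOn_eval_mul_exp_mul ht (integrableOn_exp_neg_mul_sq_mul hg hclass
    (by positivity)) ((hermite n).map (Int.castRingHom ℝ))).const_mul (sqrt 2 ^ n)).congr
    (Filter.Eventually.of_forall fun x => ?_)
  simp only [physHermite_div_sqrt_two_mul]
  ring

open Polynomial in
/-- Completeness of the Hermite functions on the half line, for functions of Gaussian-integrable
growth. -/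
theorem ae_eq_zero_of_hermite_transform_eq_zero {h : ℝ → ℝ} (hh : Measurable h)
    (hInt : ∀ a > 0, IntegrableOn (fun x => exp (-(a * x ^ 2)) * h x) (Ioi 0))
    {t : ℝ} (ht : 0 < t)
    (hzero : ∀ n : ℕ, ∫ x in Ioi (0 : ℝ), exp (-x ^ 2 / (2 * t))
      * physHermite n (x / sqrt (2 * t)) * h x = 0) :
    ∀ᵐ x ∂(volume.restrict (Ioi (0 : ℝ))), h x = 0 := by
  have hbase := hInt (1 / (4 * t)) (by positivity)
  have hpoly := integrableOn_eval_mul_exp_mul ht hbase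
  have hall : ∀ p : ℝ[X],
      ∫ x in Ioi 0, p.eval (x / sqrt t) * (exp (-x ^ 2 / (2 * t)) * h x) = 0 := by
    intro p
    have hp : p ∈ Submodule.span ℝ (Set.range fun n => (hermite n).map (Int.castRingHom ℝ)) := by
      rw [span_range_hermite_map]
      trivial
    induction hp using Submodule.span_induction with
    | mem q hq =>
      obtain ⟨n, rfl⟩ := hq
      have hn := hzero n
      simp only [physHermite_div_sqrt_two_mul] at hn
      have h2 : sqrt 2 ^ n ≠ 0 := by positivity
      refine (mul_eq_zero.1 ?_).resolve_left h2
      rw [← integral_const_mul]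
      refine Eq.trans (integral_congr_ae (Filter.Eventually.of_forall fun x => ?_)) hn
      ring
    | zero => simp
    | add p q _ _ hp hq =>
      simp only [eval_add, add_mul]
      rw [integral_add (hpoly p) (hpoly q), hp, hq, add_zero]
    | smul c p _ hp =>
      simp only [eval_smul, smul_eq_mul, mul_assoc]
      rw [integral_const_mul, hp, mul_zero]
  have hw := ae_eq_zero_of_moments_eq_zero (μ := volume.restrict (Ioi 0))
    (w := fun x => exp (-x ^ 2 / (2 * t)) * h x) (by fun_prop) ?_ ?_
  · filter_upwards [hw] with x hx
    exact (mul_eq_zero.1 hx).resolve_left (exp_pos _).ne'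
  · intro c
    have := Integrable.bdd_mul (c := exp (c ^ 2 * t)) hbase
      (f := fun x => exp (c * x) * exp (-(1 / (4 * t) * x ^ 2))) (by fun_prop)
      (Filter.Eventually.of_forall fun x => by
        rw [← exp_add, norm_eq_abs, abs_exp, exp_le_exp]
        have e : c ^ 2 * t - (c * x + -(1 / (4 * t) * x ^ 2)) = (x - 2 * t * c) ^ 2 / (4 * t) := by
          field_simp
          ring
        have : 0 ≤ (x - 2 * t * c) ^ 2 / (4 * t) := by positivity
        linarith)
    refine this.congr (Filter.Eventually.of_forall fun x => ?_)
    simp only [exp_neg_sq_div_two_mul x]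
    ring
  · intro n
    have hs : sqrt t ≠ 0 := by positivity
    refine Eq.trans (integral_congr_ae (Filter.Eventually.of_forall fun x => ?_))
      (hall (C (sqrt t ^ n) * X ^ n))
    simp only [eval_mul, eval_C, eval_pow, eval_X, ← mul_pow, mul_div_cancel₀ x hs]

/-- The Hermite transform of a solution of the integral equation. -/
theorem hermite_transform_eq
    {b : ℝ → ℝ} (hb : ContinuousOn b (Ici 0))
    {K : ℝ → ℝ → ℝ} (hKmeas : Measurable (Function.uncurry K))
    (hKnonneg : ∀ t ∈ Ioi (0 : ℝ), ∀ x ∈ Ioi (0 : ℝ), 0 ≤ K t x)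
    (hK : ∀ n : ℕ, ∀ x ∈ Ioi (0 : ℝ), ∀ t ∈ Ioi (0 : ℝ), 0 < b t →
      t ^ (-(((n : ℝ) + 1) / 2)) * exp (-x ^ 2 / (2 * t)) * physHermite n (x / sqrt (2 * t))
        = ∫ s in Ioo (0 : ℝ) t, boundaryKernel b n t s * K s x)
    {f g : ℝ → ℝ} (hg : Measurable g)
    (hgclass : IntegrableOn g (Ioi 0) ∨ ∃ M : ℝ, ∀ x ∈ Ioi (0 : ℝ), |g x| ≤ M)
    (hsol : ∀ᵐ t ∂(volume.restrict (Ioi (0 : ℝ))), ∫ x in Ioi (0 : ℝ), K t x * g x = f t)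
    {t : ℝ} (ht : 0 < t) (hbt : 0 < b t) (n : ℕ) :
    ∫ x in Ioi (0 : ℝ), exp (-x ^ 2 / (2 * t)) * physHermite n (x / sqrt (2 * t)) * g x
      = t ^ (((n : ℝ) + 1) / 2) * ∫ s in Ioo (0 : ℝ) t, boundaryKernel b n t s * f s := by
  obtain ⟨C, a, ha, hCa⟩ := exists_integral_le_of_boundaryKernel hb hKmeas hKnonneg
    (fun x hx t ht hbt => by
      have hH : physHermite 0 (x / sqrt (2 * t)) = 1 := by
        rw [physHermite_div_sqrt_two_mul]
        simp
      have := hK 0 x hx t ht hbt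
      rwa [hH, mul_one, Nat.cast_zero, zero_add] at this) ht hbt
  have hG := integrable_kernel_mul_prod hKmeas hKnonneg hCa hg
    (integrableOn_exp_neg_mul_sq_mul hg hgclass ha)
  obtain ⟨D, hD⟩ := exists_abs_boundaryKernel_le hb n ht hbt
  have hφ : AEStronglyMeasurable (boundaryKernel b n t) (volume.restrict (Ioo 0 t)) :=
    (continuousOn_boundaryKernel hb n t).aestronglyMeasurable measurableSet_Ioo
  have hF : Integrable (fun p : ℝ × ℝ => boundaryKernel b n t p.1 * (K p.1 p.2 * g p.2))
      ((volume.restrict (Ioo 0 t)).prod (volume.restrict (Ioi 0))) := by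
    refine Integrable.bdd_mul (c := D) hG hφ.comp_fst ?_
    exact Measure.quasiMeasurePreserving_fst.ae
      ((ae_restrict_iff' measurableSet_Ioo).2 (Filter.Eventually.of_forall hD))
  have hsol' : ∀ᵐ s ∂(volume.restrict (Ioo 0 t)), ∫ x in Ioi (0 : ℝ), K s x * g x = f s :=
    ae_restrict_of_ae_restrict_of_subset Ioo_subset_Ioi_self hsol
  calc ∫ x in Ioi (0 : ℝ), exp (-x ^ 2 / (2 * t)) * physHermite n (x / sqrt (2 * t)) * g x
      = ∫ x in Ioi (0 : ℝ), t ^ (((n : ℝ) + 1) / 2)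
          * ∫ s in Ioo (0 : ℝ) t, boundaryKernel b n t s * (K s x * g x) := by
        refine setIntegral_congr_fun measurableSet_Ioi fun x hx => ?_
        simp only [← mul_assoc (boundaryKernel b n t _)]
        rw [integral_mul_const, ← hK n x hx t ht hbt, rpow_neg ht.le]
        have : t ^ (((n : ℝ) + 1) / 2) ≠ 0 := (rpow_pos_of_pos ht _).ne'
        field_simp
    _ = t ^ (((n : ℝ) + 1) / 2) * ∫ s in Ioo (0 : ℝ) t, ∫ x in Ioi (0 : ℝ),
          boundaryKernel b n t s * (K s x * g x) := by
        rw [integral_const_mul, ← integral_integral_swap hF]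
    _ = _ := by
        congr 1
        refine integral_congr_ae ?_
        filter_upwards [hsol'] with s hs
        rw [integral_const_mul, hs]

/-- **Hermite transform representation and uniqueness for the RFPT problem.**
If `g` solves the Fredholm equation, its Hermite transform is determined by the
coefficients `aₙ(t)`, and any two such solutions agree a.e. on `(0,∞)`. -/
theorem rfpt_hermite_transform
    (b : ℝ → ℝ) (hb : ContinuousOn b (Ici 0)) (hbpos : ∃ t > (0 : ℝ), 0 < b t)
    (K : ℝ → ℝ → ℝ) (hKmeas : Measurable (Function.uncurry K))
    (hKnonneg : ∀ t ∈ Ioi (0 : ℝ), ∀ x ∈ Ioi (0 : ℝ), 0 ≤ K t x)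
    (hK : ∀ n : ℕ, ∀ x ∈ Ioi (0 : ℝ), ∀ t ∈ Ioi (0 : ℝ), 0 < b t →
      t ^ (-(((n : ℝ) + 1) / 2)) * Real.exp (-x ^ 2 / (2 * t))
          * physHermite n (x / Real.sqrt (2 * t))
        = ∫ s in Ioo (0 : ℝ) t, (t - s) ^ (-(((n : ℝ) + 1) / 2))
            * Real.exp (-(b s) ^ 2 / (2 * (t - s)))
            * physHermite n (b s / Real.sqrt (2 * (t - s))) * K s x)
    (f : ℝ → ℝ) (hfmeas : Measurable f) (hfnonneg : ∀ t ∈ Ioi (0 : ℝ), 0 ≤ f t)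
    (hfint : ∫ t in Ioi (0 : ℝ), f t = 1)
    (g : ℝ → ℝ) (hgmeas : Measurable g)
    (hgclass : IntegrableOn g (Ioi 0) ∨ ∃ M : ℝ, ∀ x ∈ Ioi (0 : ℝ), |g x| ≤ M)
    (hgL2 : IntegrableOn (fun x => (g x) ^ 2 * Real.exp (-x ^ 2)) (Ioi 0))
    (hsol : ∀ᵐ t ∂(volume.restrict (Ioi (0 : ℝ))), ∫ x in Ioi (0 : ℝ), K t x * g x = f t) :
    (∀ t ∈ Ioi (0 : ℝ), 0 < b t → ∀ n : ℕ,
      ∫ x in Ioi (0 : ℝ), Real.exp (-x ^ 2 / (2 * t))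
          * physHermite n (x / Real.sqrt (2 * t)) * g x
        = t ^ (((n : ℝ) + 1) / 2) *
            ∫ s in Ioo (0 : ℝ) t, (t - s) ^ (-(((n : ℝ) + 1) / 2))
              * Real.exp (-(b s) ^ 2 / (2 * (t - s)))
              * physHermite n (b s / Real.sqrt (2 * (t - s))) * f s) ∧
    (∀ g₂ : ℝ → ℝ, Measurable g₂ →
      (IntegrableOn g₂ (Ioi 0) ∨ ∃ M : ℝ, ∀ x ∈ Ioi (0 : ℝ), |g₂ x| ≤ M) →
      IntegrableOn (fun x => (g₂ x) ^ 2 * Real.exp (-x ^ 2)) (Ioi 0) →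
      (∀ᵐ t ∂(volume.restrict (Ioi (0 : ℝ))), ∫ x in Ioi (0 : ℝ), K t x * g₂ x = f t) →
      ∀ᵐ x ∂(volume.restrict (Ioi (0 : ℝ))), g x = g₂ x) := by
  have hpart : ∀ g : ℝ → ℝ, Measurable g →
      (IntegrableOn g (Ioi 0) ∨ ∃ M : ℝ, ∀ x ∈ Ioi (0 : ℝ), |g x| ≤ M) →
      (∀ᵐ t ∂(volume.restrict (Ioi (0 : ℝ))), ∫ x in Ioi (0 : ℝ), K t x * g x = f t) →
      ∀ t ∈ Ioi (0 : ℝ), 0 < b t → ∀ n : ℕ,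
      ∫ x in Ioi (0 : ℝ), exp (-x ^ 2 / (2 * t)) * physHermite n (x / sqrt (2 * t)) * g x
        = t ^ (((n : ℝ) + 1) / 2) * ∫ s in Ioo (0 : ℝ) t, boundaryKernel b n t s * f s :=
    fun g hg hgc hgs t ht hbt n =>
      hermite_transform_eq hb hKmeas hKnonneg hK hg hgc hgs ht hbt n
  refine ⟨hpart g hgmeas hgclass hsol, fun g₂ hg₂ hg₂class _ hsol₂ => ?_⟩
  obtain ⟨t, ht, hbt⟩ := hbpos
  have hzero := ae_eq_zero_of_hermite_transform_eq_zero (h := fun x => g x - g₂ x)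
    (hgmeas.sub hg₂) (fun a ha => by
      simpa only [mul_sub] using! (integrableOn_exp_neg_mul_sq_mul hgmeas hgclass ha).sub
        (integrableOn_exp_neg_mul_sq_mul hg₂ hg₂class ha)) ht fun n => by
      simp only [mul_sub]
      rw [integral_sub (integrableOn_exp_mul_physHermite_mul hgmeas hgclass ht n)
        (integrableOn_exp_mul_physHermite_mul hg₂ hg₂class ht n),
        hpart g hgmeas hgclass hsol t ht hbt n, hpart g₂ hg₂ hg₂class hsol₂ t ht hbt n, sub_self]
  filter_upwards [hzero] with x hx
  exact sub_eq_zero.1 hx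
end

section
/- Let f be a probability density on (0,∞), let b : [0,∞) → ℝ be continuous with t ↦ b(t) + α·t bounded below on [0,∞) for every α > 0, and assume there exists ε > 0 such that ∫₀^ε exp(β·b(t)/√t)·f(t) dt < ∞ for every β > 0. Define r(α) := ∫₀^∞ exp(−α·b(t) − α²·t/2)·f(t) dt for α > 0. Then r is completely monotone on (0,∞) if and only if for every integer n ≥ 1 and every α > 0: ∫₀^∞ t^{n/2}·exp(−α·b(t) − α²·t/2)·H_n((b(t) + α·t)/√(2t))·f(t) dt ≥ 0. -/
open MeasureTheory Real Set

/-- A function `r` is completely monotone on `(0,∞)` if it is infinitely differentiable there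
and `(−1)^n r^{(n)}(α) ≥ 0` for every `n ≥ 0` and every `α > 0`. -/
def CompletelyMonotoneOn (r : ℝ → ℝ) : Prop :=
  ContDiffOn ℝ ((⊤ : ℕ∞) : WithTop ℕ∞) r (Ioi 0) ∧
    ∀ n : ℕ, ∀ α ∈ Ioi (0 : ℝ), 0 ≤ (-1 : ℝ) ^ n * iteratedDerivWithin n r (Ioi 0) α

/-- The polynomials `Q_n(s, t)` in the derivatives of a Gaussian exponential: with `s = b + α t`,
`(d/dα)^n exp(-α b - α² t / 2) = Q_n(s, t) exp(-α b - α² t / 2)`. -/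
noncomputable def gaussianFactor : ℕ → ℝ → ℝ → ℝ
  | 0, _, _ => 1
  | 1, s, _ => -s
  | n + 2, s, t => -(s * gaussianFactor (n + 1) s t + (n + 1) * t * gaussianFactor n s t)

lemma continuous_gaussianFactor (n : ℕ) :
    Continuous fun p : ℝ × ℝ => gaussianFactor n p.1 p.2 := by
  induction n using Nat.twoStepInduction with
  | zero => simpa [gaussianFactor] using continuous_const
  | one => simpa only [gaussianFactor] using (continuous_fst (X := ℝ) (Y := ℝ)).fun_neg
  | more n h0 h1 =>
    simp only [gaussianFactor]
    fun_prop

lemma abs_gaussianFactor_le (n : ℕ) :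
    ∃ C : ℝ, 0 ≤ C ∧ ∀ s t : ℝ, 0 ≤ t → |gaussianFactor n s t| ≤ C * (1 + |s| + t) ^ n := by
  induction n using Nat.twoStepInduction with
  | zero => exact ⟨1, by simp, by simp [gaussianFactor]⟩
  | one =>
    refine ⟨1, by simp, fun s t ht => ?_⟩
    simp only [gaussianFactor, abs_neg, pow_one]
    linarith
  | more n h0 h1 =>
    obtain ⟨C, hC, h0⟩ := h0
    obtain ⟨D, hD, h1⟩ := h1
    refine ⟨D + (n + 1) * C, by positivity, fun s t ht => ?_⟩
    have hs := abs_nonneg s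
    set X := 1 + |s| + t with hX
    have hX1 : 1 ≤ X := by linarith
    have hX0 : 0 ≤ X := by linarith
    calc |gaussianFactor (n + 2) s t|
        ≤ |s| * |gaussianFactor (n + 1) s t| + (n + 1) * t * |gaussianFactor n s t| := by
          simp only [gaussianFactor, abs_neg]
          refine (abs_add_le _ _).trans_eq ?_
          rw [abs_mul, abs_mul, abs_of_nonneg (by positivity : (0 : ℝ) ≤ (n + 1) * t)]
      _ ≤ X * (D * X ^ (n + 1)) + (n + 1) * (X * X) * (C * X ^ n) := by
          gcongr
          · linarith
          · exact h1 s t ht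
          · nlinarith
          · exact h0 s t ht
      _ = (D + (n + 1) * C) * X ^ (n + 2) := by ring

lemma hasDerivAt_gaussianFactor_succ (n : ℕ) (s t : ℝ) :
    HasDerivAt (fun s => gaussianFactor (n + 1) s t) (-((n + 1) * gaussianFactor n s t)) s := by
  induction n using Nat.twoStepInduction with
  | zero => exact (hasDerivAt_id s).neg.congr_deriv (by simp [gaussianFactor])
  | one =>
    have h : HasDerivAt (fun s => -(s * -s + ((0 : ℕ) + 1 : ℝ) * t * 1)) _ s :=
      (((hasDerivAt_id s).mul (hasDerivAt_id s).neg).add_const _).neg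
    refine h.congr_deriv ?_
    simp [gaussianFactor]
    ring
  | more n h0 h1 =>
    have h := (((hasDerivAt_id s).mul h1).add (h0.const_mul (((n + 1 : ℕ) + 1 : ℝ) * t))).neg
    refine h.congr_deriv ?_
    simp only [gaussianFactor, id]
    push_cast
    ring

lemma hasDerivAt_gaussianFactor_mul_exp (n : ℕ) (b t α : ℝ) :
    HasDerivAt (fun α => gaussianFactor n (b + α * t) t * exp (-α * b - α ^ 2 * t / 2))
      (gaussianFactor (n + 1) (b + α * t) t * exp (-α * b - α ^ 2 * t / 2)) α := by
  have hs : HasDerivAt (fun α : ℝ => b + α * t) t α := by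
    simpa using ((hasDerivAt_id α).mul_const t).const_add b
  have he : HasDerivAt (fun α : ℝ => exp (-α * b - α ^ 2 * t / 2))
      (exp (-α * b - α ^ 2 * t / 2) * -(b + α * t)) α := by
    refine HasDerivAt.exp ?_
    refine (((hasDerivAt_id α).neg.mul_const b).sub
      ((((hasDerivAt_id α).pow 2).mul_const t).div_const 2)).congr_deriv ?_
    simp
    ring
  cases n with
  | zero =>
    simp only [gaussianFactor, one_mul]
    exact he.congr_deriv (by ring)
  | succ n =>
    refine (((hasDerivAt_gaussianFactor_succ n (b + α * t) t).comp α hs).mul he).congr_deriv ?_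
    simp only [gaussianFactor, Function.comp]
    ring

lemma iteratedDeriv_exp_quadratic (n : ℕ) (b t : ℝ) :
    iteratedDeriv n (fun α : ℝ => exp (-α * b - α ^ 2 * t / 2)) =
      fun α => gaussianFactor n (b + α * t) t * exp (-α * b - α ^ 2 * t / 2) := by
  induction n with
  | zero => simp [gaussianFactor]
  | succ n ih =>
    rw [iteratedDeriv_succ, ih]
    exact funext fun α => (hasDerivAt_gaussianFactor_mul_exp n b t α).deriv

lemma iteratedDeriv_exp_neg_sq (n : ℕ) (y : ℝ) :
    iteratedDeriv n (fun y : ℝ => exp (-y ^ 2)) y =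
      (-1) ^ n * (physHermite n y * exp (-y ^ 2)) := by
  have h : exp (y ^ 2) * exp (-y ^ 2) = 1 := by rw [← exp_add]; simp
  have h1 : ((-1 : ℝ) ^ n) * (-1) ^ n = 1 := by rw [← mul_pow]; simp
  unfold physHermite
  linear_combination (-iteratedDeriv n (fun y : ℝ => exp (-y ^ 2)) y) *
    ((-1) ^ n * (-1) ^ n * h + h1)

lemma gaussianFactor_mul_exp_eq_physHermite (n : ℕ) (b α : ℝ) {t : ℝ} (ht : 0 < t) :
    (√2) ^ n * ((-1) ^ n * (gaussianFactor n (b + α * t) t * exp (-α * b - α ^ 2 * t / 2))) =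
      t ^ ((n : ℝ) / 2) * exp (-α * b - α ^ 2 * t / 2) *
        physHermite n ((b + α * t) / √(2 * t)) := by
  set w := √(2 * t) with hw
  have hw0 : 0 < w := by positivity
  have hw2 : w ^ 2 = 2 * t := sq_sqrt (by positivity)
  have harg (x : ℝ) : w / 2 * x + b / w = (b + x * t) / w := by
    field_simp
    rw [hw2]
    ring
  have hexp (x : ℝ) :
      exp (-x * b - x ^ 2 * t / 2) = exp (b ^ 2 / (2 * t)) * exp (-(w / 2 * x + b / w) ^ 2) := by
    rw [← exp_add, harg, div_pow, hw2]
    congr 1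
    field_simp
    ring
  have hscale : √2 * (w / 2) = √t := by
    have h2 : √2 * √2 = 2 := mul_self_sqrt (by norm_num)
    rw [hw, sqrt_mul (by norm_num)]
    linear_combination √t / 2 * h2
  have hpow : t ^ ((n : ℝ) / 2) = (√2 * (w / 2)) ^ n := by
    rw [hscale, sqrt_eq_rpow, ← rpow_natCast, ← rpow_mul ht.le]
    congr 1
    ring
  have hder : gaussianFactor n (b + α * t) t * exp (-α * b - α ^ 2 * t / 2) =
      exp (b ^ 2 / (2 * t)) * ((w / 2) ^ n *
        iteratedDeriv n (fun y : ℝ => exp (-y ^ 2)) (w / 2 * α + b / w)) := by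
    rw [← congrFun (iteratedDeriv_exp_quadratic n b t) α, funext hexp,
      iteratedDeriv_const_mul_field]
    congr 1
    have hshift : ContDiff ℝ n fun y : ℝ => exp (-(y + b / w) ^ 2) := by fun_prop
    rw [iteratedDeriv_comp_const_mul (f := fun y : ℝ => exp (-(y + b / w) ^ 2)) hshift,
      iteratedDeriv_comp_add_const n (fun y : ℝ => exp (-y ^ 2))]
  have hsign : ((-1 : ℝ) ^ n) * (-1) ^ n = 1 := by rw [← mul_pow]; simp
  rw [hder, iteratedDeriv_exp_neg_sq, hexp α, hpow, harg, mul_pow]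
  linear_combination (√2 ^ n * (w / 2) ^ n * exp (b ^ 2 / (2 * t)) *
    physHermite n ((b + α * t) / w) * exp (-((b + α * t) / w) ^ 2)) * hsign

lemma one_add_pow_mul_exp_neg_le (n : ℕ) {c x : ℝ} (hc : 0 < c) (hx : 0 ≤ x) :
    (1 + x) ^ n * exp (-(c * x)) ≤ n.factorial * exp c / c ^ n := by
  have h := pow_div_factorial_le_exp (x := c * (1 + x)) (by positivity) n
  rw [mul_pow, div_le_iff₀ (by positivity), mul_add, mul_one, exp_add] at h
  have h1 : exp (c * x) * exp (-(c * x)) = 1 := by rw [← exp_add]; simp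
  rw [le_div_iff₀ (by positivity)]
  calc (1 + x) ^ n * exp (-(c * x)) * c ^ n = c ^ n * (1 + x) ^ n * exp (-(c * x)) := by ring
    _ ≤ exp c * exp (c * x) * n.factorial * exp (-(c * x)) := by gcongr
    _ = n.factorial * exp c := by linear_combination (exp c * n.factorial) * h1

/-- Locally uniform bound for the `α`-derivatives of `exp (-α b(t) - α² t / 2)`. -/
lemma exists_forall_ball_abs_gaussianFactor_mul_exp_le {b : ℝ → ℝ}
    (hbdd : ∀ α > (0 : ℝ), ∃ m : ℝ, ∀ t ∈ Ici (0 : ℝ), m ≤ b t + α * t)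
    (n : ℕ) {α₀ : ℝ} (hα₀ : 0 < α₀) :
    ∃ C : ℝ, ∀ t, 0 ≤ t → ∀ α ∈ Metric.ball α₀ (α₀ / 2),
      |gaussianFactor n (b t + α * t) t * exp (-α * b t - α ^ 2 * t / 2)| ≤ C := by
  obtain ⟨m, hm⟩ := hbdd (α₀ / 8) (by positivity)
  obtain ⟨D, hD, hQ⟩ := abs_gaussianFactor_le n
  set c := min (α₀ / 2) (α₀ ^ 2 / 16)
  have hc : 0 < c := by positivity
  have hc1 : c ≤ α₀ / 2 := min_le_left _ _
  have hc2 : c ≤ α₀ ^ 2 / 16 := min_le_right _ _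
  set K := 2 + |m| + 2 * α₀ with hK
  have hm0 := abs_nonneg m
  have hK0 : 0 ≤ K := by positivity
  refine ⟨D * K ^ n * exp (2 * α₀ * |m|) * (n.factorial * exp c / c ^ n), fun t ht α hα => ?_⟩
  rw [Metric.mem_ball, Real.dist_eq, abs_lt] at hα
  have hα1 : α₀ / 2 ≤ α := by linarith
  have hα2 : α ≤ 2 * α₀ := by linarith
  have hα0 : 0 < α := by linarith
  have hu : 0 ≤ b t + α₀ / 8 * t - m := by linarith [hm t ht]
  set u := b t + α₀ / 8 * t - m with hu_def
  have hbt : b t = u + m - α₀ / 8 * t := by rw [hu_def]; ring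
  have hx : 0 ≤ u + t := by positivity
  have hs : 1 + |b t + α * t| + t ≤ K * (1 + (u + t)) := by
    have : |b t + α * t| ≤ u + |m| + (α - α₀ / 8) * t := by
      rw [hbt, show u + m - α₀ / 8 * t + α * t = u + m + (α - α₀ / 8) * t by ring]
      refine (abs_add_le _ _).trans (add_le_add ((abs_add_le _ _).trans ?_) ?_)
      · rw [abs_of_nonneg hu]
      · rw [abs_of_nonneg (mul_nonneg (by linarith) ht)]
    have h1 : (α - α₀ / 8) * t ≤ 2 * α₀ * t := by gcongr; linarith
    have h2 : 0 ≤ |m| * (u + t) := by positivity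
    have h3 : 0 ≤ α₀ * (1 + u) := by positivity
    rw [hK]
    nlinarith
  have he : -α * b t - α ^ 2 * t / 2 ≤ 2 * α₀ * |m| + -(c * (u + t)) := by
    have h1 : c * u ≤ α * u := by gcongr; linarith
    have h2 : α * (-m) ≤ 2 * α₀ * |m| :=
      (mul_le_mul_of_nonneg_left (neg_le_abs m) hα0.le).trans (by gcongr)
    have h3 : c ≤ α * (α / 2 - α₀ / 8) := by nlinarith
    have h4 : c * t ≤ α * (α / 2 - α₀ / 8) * t := by gcongr
    rw [hbt]
    nlinarith
  calc |gaussianFactor n (b t + α * t) t * exp (-α * b t - α ^ 2 * t / 2)|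
      = |gaussianFactor n (b t + α * t) t| * exp (-α * b t - α ^ 2 * t / 2) := by
        rw [abs_mul, abs_exp]
    _ ≤ D * (K * (1 + (u + t))) ^ n * exp (2 * α₀ * |m| + -(c * (u + t))) := by
        gcongr
        refine (hQ _ _ ht).trans ?_
        gcongr
    _ = D * K ^ n * exp (2 * α₀ * |m|) * ((1 + (u + t)) ^ n * exp (-(c * (u + t)))) := by
        rw [exp_add, mul_pow]
        ring
    _ ≤ _ := by
        gcongr
        exact one_add_pow_mul_exp_neg_le n hc hx

lemma hasDerivAt_integral_gaussianFactor {f b : ℝ → ℝ} (hf : IntegrableOn f (Ioi 0))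
    (hb : ContinuousOn b (Ici 0))
    (hbdd : ∀ α > (0 : ℝ), ∃ m : ℝ, ∀ t ∈ Ici (0 : ℝ), m ≤ b t + α * t)
    (n : ℕ) {α₀ : ℝ} (hα₀ : 0 < α₀) :
    HasDerivAt
      (fun α => ∫ t in Ioi (0 : ℝ),
        gaussianFactor n (b t + α * t) t * exp (-α * b t - α ^ 2 * t / 2) * f t)
      (∫ t in Ioi (0 : ℝ),
        gaussianFactor (n + 1) (b t + α₀ * t) t * exp (-α₀ * b t - α₀ ^ 2 * t / 2) * f t) α₀ := by
  have hcont (k : ℕ) (α : ℝ) : ContinuousOn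
      (fun t => gaussianFactor k (b t + α * t) t * exp (-α * b t - α ^ 2 * t / 2)) (Ioi 0) := by
    have hb' : ContinuousOn b (Ioi 0) := hb.mono Ioi_subset_Ici_self
    refine ContinuousOn.mul ?_ (by fun_prop)
    exact (continuous_gaussianFactor k).comp_continuousOn
      (f := fun t => (b t + α * t, t)) (by fun_prop)
  have hmeas (k : ℕ) (α : ℝ) : AEStronglyMeasurable
      (fun t => gaussianFactor k (b t + α * t) t * exp (-α * b t - α ^ 2 * t / 2))
      (volume.restrict (Ioi 0)) :=
    (hcont k α).aestronglyMeasurable measurableSet_Ioi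
  obtain ⟨C, hC⟩ := exists_forall_ball_abs_gaussianFactor_mul_exp_le hbdd n hα₀
  obtain ⟨D, hD⟩ := exists_forall_ball_abs_gaussianFactor_mul_exp_le hbdd (n + 1) hα₀
  refine (hasDerivAt_integral_of_dominated_loc_of_deriv_le (bound := fun t => D * |f t|)
    (F' := fun α t => gaussianFactor (n + 1) (b t + α * t) t * exp (-α * b t - α ^ 2 * t / 2) * f t)
    (Metric.ball_mem_nhds α₀ (half_pos hα₀)) ?_ ?_ ?_ ?_ ?_ ?_).2
  · exact .of_forall fun α => (hmeas n α).mul hf.aestronglyMeasurable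
  · refine hf.bdd_mul (hmeas n α₀) (c := C) ?_
    filter_upwards [ae_restrict_mem measurableSet_Ioi] with t ht
    exact hC t (le_of_lt ht) α₀ (Metric.mem_ball_self (half_pos hα₀))
  · exact (hmeas (n + 1) α₀).mul hf.aestronglyMeasurable
  · filter_upwards [ae_restrict_mem measurableSet_Ioi] with t ht α hα
    rw [norm_mul]
    exact mul_le_mul_of_nonneg_right (hD t (le_of_lt ht) α hα) (norm_nonneg _)
  · exact hf.abs.const_mul D
  · exact .of_forall fun t α _ => (hasDerivAt_gaussianFactor_mul_exp n (b t) t α).mul_const (f t)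

lemma iteratedDerivWithin_eqOn_of_hasDerivAt {s : Set ℝ} (hs : IsOpen s) {F : ℕ → ℝ → ℝ}
    (hF : ∀ n, ∀ x ∈ s, HasDerivAt (F n) (F (n + 1) x) x) (n : ℕ) :
    EqOn (iteratedDerivWithin n (F 0) s) (F n) s := by
  induction n with
  | zero => simp [EqOn]
  | succ n ih =>
    intro x hx
    rw [iteratedDerivWithin_succ, derivWithin_congr ih (ih hx), derivWithin_of_isOpen hs hx]
    exact (hF n x hx).deriv

lemma contDiffOn_of_hasDerivAt {s : Set ℝ} (hs : IsOpen s) {F : ℕ → ℝ → ℝ}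
    (hF : ∀ n, ∀ x ∈ s, HasDerivAt (F n) (F (n + 1) x) x) :
    ContDiffOn ℝ ((⊤ : ℕ∞) : WithTop ℕ∞) (F 0) s := by
  refine contDiffOn_of_differentiableOn_deriv fun m _ => ?_
  refine DifferentiableOn.congr (fun x hx => ?_) (iteratedDerivWithin_eqOn_of_hasDerivAt hs hF m)
  exact (hF m x hx).differentiableAt.differentiableWithinAt

/-- **Complete monotonicity criterion.** `r(α) = ∫₀^∞ e^{−αb(t)−α²t/2} f(t) dt` is completely
monotone on `(0,∞)` iff the Hermite-weighted integrals are nonnegative for all `n ≥ 1`, `α > 0`. -/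
theorem completely_monotone_iff_hermite_nonneg
    (f : ℝ → ℝ) (hfmeas : Measurable f) (hfnonneg : ∀ t ∈ Ioi (0 : ℝ), 0 ≤ f t)
    (hfint : ∫ t in Ioi (0 : ℝ), f t = 1)
    (b : ℝ → ℝ) (hb : ContinuousOn b (Ici 0))
    (hbdd : ∀ α > (0 : ℝ), ∃ m : ℝ, ∀ t ∈ Ici (0 : ℝ), m ≤ b t + α * t)
    (hsmall : ∃ ε > (0 : ℝ), ∀ β > (0 : ℝ),
      IntegrableOn (fun t => Real.exp (β * b t / Real.sqrt t) * f t) (Ioo 0 ε)) :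
    CompletelyMonotoneOn
        (fun α => ∫ t in Ioi (0 : ℝ), Real.exp (-α * b t - α ^ 2 * t / 2) * f t)
      ↔ ∀ n : ℕ, 1 ≤ n → ∀ α > (0 : ℝ),
          0 ≤ ∫ t in Ioi (0 : ℝ), t ^ ((n : ℝ) / 2) * Real.exp (-α * b t - α ^ 2 * t / 2)
                * physHermite n ((b t + α * t) / Real.sqrt (2 * t)) * f t := by
  have hf : IntegrableOn f (Ioi 0) := by
    by_contra h
    exact zero_ne_one ((integral_undef h).symm.trans hfint)
  set F : ℕ → ℝ → ℝ := fun n α => ∫ t in Ioi (0 : ℝ),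
    gaussianFactor n (b t + α * t) t * exp (-α * b t - α ^ 2 * t / 2) * f t with hF_def
  have hF : ∀ n, ∀ α ∈ Ioi (0 : ℝ), HasDerivAt (F n) (F (n + 1) α) α := fun n α hα =>
    hasDerivAt_integral_gaussianFactor hf hb hbdd n hα
  have hF0 : (fun α => ∫ t in Ioi (0 : ℝ), exp (-α * b t - α ^ 2 * t / 2) * f t) = F 0 := by
    simp [hF_def, gaussianFactor]
  have hHermite (n : ℕ) (α : ℝ) :
      ∫ t in Ioi (0 : ℝ), t ^ ((n : ℝ) / 2) * exp (-α * b t - α ^ 2 * t / 2)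
        * physHermite n ((b t + α * t) / √(2 * t)) * f t = √2 ^ n * ((-1) ^ n * F n α) := by
    rw [hF_def, ← integral_const_mul, ← integral_const_mul]
    refine setIntegral_congr_fun measurableSet_Ioi fun t ht => ?_
    simp only [← gaussianFactor_mul_exp_eq_physHermite n (b t) α ht]
    ring
  have hpos (n : ℕ) : 0 < √(2 : ℝ) ^ n := by positivity
  simp only [hHermite, mul_nonneg_iff_of_pos_left (hpos _), hF0]
  refine ⟨fun h n _ α hα => ?_, fun h => ⟨contDiffOn_of_hasDerivAt isOpen_Ioi hF,
    fun n α hα => ?_⟩⟩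
  · simpa only [iteratedDerivWithin_eqOn_of_hasDerivAt isOpen_Ioi hF n hα] using h.2 n α hα
  · rw [iteratedDerivWithin_eqOn_of_hasDerivAt isOpen_Ioi hF n hα]
    rcases Nat.eq_zero_or_pos n with rfl | hn
    · rw [pow_zero, one_mul, ← hF0]
      exact setIntegral_nonneg measurableSet_Ioi fun t ht =>
        mul_nonneg (exp_pos _).le (hfnonneg t ht)
    · exact h n hn α hα
end
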